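/- Fix a totally real number field K₀ of class number one and degree N over ℚ, and let φ be an even Schwartz function on ℝ with compactly supported Fourier transform φ̂. For a CM-field K with maximal totally real subfield K₀, class number h_K, and Δ = Δ_K, define S_{2,1}(Δ, φ)₂ = −2 · ∑_𝔭 log N𝔭 · ∑_{m ≥ 1, gcd(m, h_K) = 1} φ̂(m·log N𝔭 / log Δ) / N𝔭^{m/2}, where the outer sum runs over the principal prime ideals 𝔭 of O_K whose absolute norm is the square of a rational prime. Then there is a constant C > 0 (depending only on φ and N) such that for every such CM-field K, |S_{2,1}(Δ, φ)₂ + 2 · ∑_𝔭 (log N𝔭 / N𝔭^{1/2}) · φ̂(log N𝔭 / log Δ)| ≤ C, where the last sum runs over the same set of prime ideals 𝔭. -/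

import Mathlib

open NumberField FourierTransform

/-- The sum `S_{2,1}(Δ, φ)₂ = −2·∑_𝔭 log N𝔭 · ∑_{m ≥ 1, (m, h_K) = 1}
φ̂(m·log N𝔭/log Δ)/N𝔭^{m/2}`, the outer sum running over the principal prime ideals of
`O_K` whose absolute norm is the square of a rational prime. -/
noncomputable def S21two.{v} (K : Type v) [Field K] [NumberField K]
    (φ : SchwartzMap ℝ ℂ) (Δ : ℝ) : ℂ :=
  (-2 : ℂ) * ∑' 𝔭 : {𝔭 : Ideal (𝓞 K) // 𝔭.IsPrime ∧ Submodule.IsPrincipal 𝔭 ∧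
      ∃ p : ℕ, p.Prime ∧ Ideal.absNorm 𝔭 = p ^ 2},
    (Real.log (Ideal.absNorm 𝔭.1) : ℂ) *
      ∑' m : {m : ℕ // 1 ≤ m ∧ Nat.Coprime m (NumberField.classNumber K)},
        𝓕 ⇑φ ((m : ℝ) * Real.log (Ideal.absNorm 𝔭.1) / Real.log Δ) /
          ((((Ideal.absNorm 𝔭.1 : ℝ) ^ (((m : ℕ) : ℝ) / 2)) : ℝ) : ℂ)

/-- If the fibers of `π` have at most `k` elements, pulling a nonnegative summable function back
along `π` multiplies its sum by at most `k`. -/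
lemma summable_comp_of_card_fiber_le {ι κ : Type*} [DecidableEq κ] {π : ι → κ} {k : ℕ}
    (hk : ∀ (s : Finset ι) (b : κ), (s.filter (π · = b)).card ≤ k)
    {g : κ → ℝ} (hg0 : ∀ b, 0 ≤ g b) (hg : Summable g) :
    Summable (fun i ↦ g (π i)) ∧ ∑' i, g (π i) ≤ k * ∑' b, g b := by
  have key (s : Finset ι) : ∑ i ∈ s, g (π i) ≤ k * ∑' b, g b := by
    rw [Finset.sum_comp]
    calc _ ≤ ∑ b ∈ s.image π, k * g b := by
          refine Finset.sum_le_sum fun b _ ↦ ?_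
          rw [nsmul_eq_mul]
          exact mul_le_mul_of_nonneg_right (by exact_mod_cast hk s b) (hg0 b)
      _ ≤ _ := by
          rw [← Finset.mul_sum]
          gcongr
          exact hg.sum_le_tsum _ fun b _ ↦ hg0 b
  exact ⟨summable_of_sum_le (fun i ↦ hg0 _) key, Real.tsum_le_of_sum_le (fun i ↦ hg0 _) key⟩

/-- At most `[K : ℚ] / 2` prime ideals of `𝓞 K` have norm `p ^ 2`. -/
lemma card_primes_absNorm_sq_le {K : Type*} [Field K] [NumberField K] {p : ℕ} (hp : p.Prime)
    (s : Finset (Ideal (𝓞 K))) (hs : ∀ 𝔭 ∈ s, 𝔭.IsPrime ∧ Ideal.absNorm 𝔭 = p ^ 2) :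
    2 * s.card ≤ Module.finrank ℚ K := by
  have hne (𝔭) (h : 𝔭 ∈ s) : 𝔭 ≠ ⊥ := by
    rintro rfl
    have := (hs _ h).2
    rw [Ideal.absNorm_bot] at this
    exact pow_ne_zero 2 hp.ne_zero this.symm
  have hdvd : ∏ 𝔭 ∈ s, 𝔭 ∣ Ideal.span {(p : 𝓞 K)} := by
    refine Finset.prod_dvd_of_coprime (fun 𝔭 h 𝔮 h' hne' ↦ ?_) fun 𝔭 h ↦ ?_
    · have m1 := (hs _ h).1.isMaximal (hne _ h)
      have m2 := (hs _ h').1.isMaximal (hne _ h')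
      exact Ideal.isCoprime_iff_sup_eq.mpr (m1.coprime_of_ne m2 hne')
    · rw [Ideal.dvd_span_singleton]
      refine (hs _ h).1.mem_of_pow_mem 2 ?_
      have := Ideal.absNorm_mem 𝔭
      rw [(hs _ h).2] at this
      exact_mod_cast this
  have h1 := map_dvd (Ideal.absNorm (S := 𝓞 K)) hdvd
  rw [map_prod, Finset.prod_congr rfl fun 𝔭 h ↦ (hs 𝔭 h).2, Finset.prod_const, ← pow_mul,
    Ideal.absNorm_span_natCast, RingOfIntegers.rank] at h1
  exact (Nat.pow_dvd_pow_iff_le_right hp.one_lt).mp h1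

/-- A series with geometrically decaying terms is close to its first term. -/
lemma norm_tsum_subtype_sub_le {Q : ℕ → Prop} (hQ : Q 1) {f : ℕ → ℂ} {M r : ℝ} (hr0 : 0 ≤ r)
    (hr : r ≤ 1 / 2) (hf : ∀ m, ‖f m‖ ≤ M * r ^ m) :
    ‖∑' m : {m : ℕ // 1 ≤ m ∧ Q m}, f m - f 1‖ ≤ 2 * M * r ^ 2 := by
  have hM : 0 ≤ M := by simpa using (norm_nonneg _).trans (hf 0)
  have hsum : Summable fun m : {m : ℕ // 1 ≤ m ∧ Q m} ↦ f m :=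
    .of_norm_bounded (((summable_geometric_of_lt_one hr0 (by linarith)).mul_left M).subtype _)
      fun m ↦ hf m
  rw [hsum.tsum_eq_add_tsum_ite ⟨1, le_rfl, hQ⟩, add_sub_cancel_left]
  let G : ℕ → ℝ := fun m ↦ if m < 2 then 0 else M * r ^ m
  have hG0 (m : ℕ) : 0 ≤ G m := by
    simp only [G]; split_ifs <;> positivity
  have hG : HasSum G (M * r ^ 2 * (1 - r)⁻¹) := by
    have := (hasSum_nat_add_iff (f := G) (g := M * r ^ 2 * (1 - r)⁻¹) 2).mp (by
      have h n : G (n + 2) = M * r ^ 2 * r ^ n := by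
        simp only [G, if_neg (Nat.le_add_left 2 n).not_gt]
        ring
      simpa only [h] using (hasSum_geometric_of_lt_one hr0 (by linarith)).mul_left (M * r ^ 2))
    simpa [G, Finset.sum_range_succ] using this
  refine (tsum_of_norm_bounded (g := fun m : {m : ℕ // 1 ≤ m ∧ Q m} ↦ G m)
    (hG.summable.subtype {m | 1 ≤ m ∧ Q m}).hasSum fun m ↦ ?_).trans
    ((hG.summable.tsum_subtype_le G {m | 1 ≤ m ∧ Q m} hG0).trans ?_)
  · split_ifs with h
    · simpa using hG0 m
    · have : ¬ (m : ℕ) < 2 := fun h2 ↦ h (Subtype.ext (by have := m.2.1; simp at h2 ⊢; omega))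
      simpa only [G, if_neg this] using hf m
  · rw [hG.tsum_eq]
    have : (1 - r)⁻¹ ≤ 2 := by
      rw [inv_le_comm₀ (by linarith) two_pos]; linarith
    nlinarith [mul_le_mul_of_nonneg_left this (mul_nonneg hM (sq_nonneg r))]

/-- The terms with `m ≥ 2` of a prime-power sum over primes of norm `(π i) ^ 2` contribute an
amount bounded independently of the scale `L`. -/
lemma norm_tsum_sub_tsum_le {ι : Type*} {π : ι → ℕ} (hπ : ∀ i, 2 ≤ π i) {k : ℕ}
    (hk : ∀ (s : Finset ι) (b : ℕ), (s.filter (π · = b)).card ≤ k)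
    {Q : ℕ → Prop} (hQ : Q 1) {ψ : ℝ → ℂ} (hψ : HasCompactSupport ψ) {M : ℝ}
    (hM : ∀ x, ‖ψ x‖ ≤ M) {L : ℝ} (hL : 0 < L) :
    ‖∑' i, (Real.log (π i ^ 2 : ℝ) : ℂ) * ∑' m : {m : ℕ // 1 ≤ m ∧ Q m},
        ψ (m * Real.log (π i ^ 2 : ℝ) / L) / (((π i ^ 2 : ℝ) ^ ((m : ℝ) / 2) : ℝ) : ℂ) -
      ∑' i, ((Real.log (π i ^ 2 : ℝ) / (π i ^ 2 : ℝ) ^ (1 / 2 : ℝ) : ℝ) : ℂ) *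
        ψ (Real.log (π i ^ 2 : ℝ) / L)‖ ≤ k * ∑' n : ℕ, 8 * M * (n : ℝ) ^ (-(3 / 2) : ℝ) := by
  have hM0 : 0 ≤ M := (norm_nonneg _).trans (hM 0)
  have hg0 (n : ℕ) : 0 ≤ 8 * M * (n : ℝ) ^ (-(3 / 2) : ℝ) := by positivity
  obtain ⟨hsum, hle⟩ := summable_comp_of_card_fiber_le hk hg0
    ((Real.summable_nat_rpow.mpr (by norm_num)).mul_left _)
  set F : ι → ℂ := fun i ↦ (Real.log (π i ^ 2 : ℝ) : ℂ) * ∑' m : {m : ℕ // 1 ≤ m ∧ Q m},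
        ψ (m * Real.log (π i ^ 2 : ℝ) / L) / (((π i ^ 2 : ℝ) ^ ((m : ℝ) / 2) : ℝ) : ℂ) with hF
  set G : ι → ℂ := fun i ↦ ((Real.log (π i ^ 2 : ℝ) / (π i ^ 2 : ℝ) ^ (1 / 2 : ℝ) : ℝ) : ℂ) *
        ψ (Real.log (π i ^ 2 : ℝ) / L) with hG
  have hFG (i : ι) : ‖F i - G i‖ ≤ 8 * M * (π i : ℝ) ^ (-(3 / 2) : ℝ) := by
    have h2 : (2 : ℝ) ≤ π i := by exact_mod_cast hπ i
    have hp : (0 : ℝ) < π i := by linarith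
    have hpow (m : ℕ) : (π i ^ 2 : ℝ) ^ ((m : ℝ) / 2) = (π i : ℝ) ^ m := by
      rw [← Real.rpow_natCast, ← Real.rpow_mul hp.le, ← Real.rpow_natCast]
      congr 1; push_cast; ring
    have key := norm_tsum_subtype_sub_le hQ (M := M) (r := (π i : ℝ)⁻¹)
      (f := fun m ↦ ψ (m * Real.log (π i ^ 2 : ℝ) / L) /
        (((π i ^ 2 : ℝ) ^ ((m : ℝ) / 2) : ℝ) : ℂ)) (by positivity)
      (by rw [one_div]; exact inv_anti₀ two_pos h2) (fun m ↦ by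
        rw [hpow, norm_div, Complex.norm_real, Real.norm_of_nonneg (by positivity), inv_pow,
          ← div_eq_mul_inv]
        gcongr
        exact hM _)
    have hlog : 0 ≤ Real.log (π i ^ 2 : ℝ) := Real.log_nonneg (by nlinarith)
    have hlog' : Real.log (π i ^ 2 : ℝ) ≤ 4 * (π i : ℝ) ^ (1 / 2 : ℝ) := by
      rw [Real.log_pow]
      have := Real.log_le_rpow_div hp.le (ε := 1 / 2) (by norm_num)
      push_cast; linarith
    have hGi : G i = (Real.log (π i ^ 2 : ℝ) : ℂ) * (ψ ((1 : ℕ) * Real.log (π i ^ 2 : ℝ) / L) /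
        (((π i ^ 2 : ℝ) ^ (((1 : ℕ) : ℝ) / 2) : ℝ) : ℂ)) := by
      simp only [hG, Nat.cast_one, one_mul, Complex.ofReal_div]; ring
    rw [hGi, hF, ← mul_sub, norm_mul, Complex.norm_real, Real.norm_of_nonneg hlog]
    calc _ ≤ (4 * (π i : ℝ) ^ (1 / 2 : ℝ)) * (2 * M * (π i : ℝ)⁻¹ ^ 2) := by gcongr
      _ = 8 * M * (π i : ℝ) ^ (-(3 / 2) : ℝ) := by
        rw [show (-(3 / 2) : ℝ) = 1 / 2 - (2 : ℕ) by norm_num, Real.rpow_sub hp,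
          Real.rpow_natCast]
        field_simp
        norm_num [mul_comm]
  have hGs : Summable G := by
    refine summable_of_hasFiniteSupport ?_
    obtain ⟨R, hR⟩ := hψ.isCompact.isBounded.exists_norm_le
    have hfib (b : ℕ) : {i | π i = b}.Finite := by
      by_contra h
      obtain ⟨t, ht, hc⟩ := Set.Infinite.exists_subset_card_eq h (k + 1)
      have := hk t b
      rw [Finset.filter_true_of_mem fun i hi ↦ by simpa using ht hi] at this
      omega
    refine (Set.Finite.biUnion (Set.finite_Iic ⌊Real.exp (R * L)⌋₊) fun b _ ↦ hfib b).subset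
      fun i hi ↦ ?_
    simp only [Set.mem_iUnion, Set.mem_ofPred_eq, exists_prop, exists_eq_right', Set.mem_Iic]
    have h2 : (2 : ℝ) ≤ π i := by exact_mod_cast hπ i
    have hne : ψ (Real.log (π i ^ 2 : ℝ) / L) ≠ 0 := fun h0 ↦ hi (by simp only [hG, h0, mul_zero])
    have h1 := (le_abs_self _).trans (hR _ (subset_tsupport _ hne))
    rw [div_le_iff₀ hL, Real.log_le_iff_le_exp (by positivity)] at h1
    exact Nat.le_floor (by nlinarith)
  have hd : Summable fun i ↦ F i - G i := .of_norm_bounded hsum hFG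
  have hFs : Summable F := by simpa using hd.add hGs
  rw [← hFs.tsum_sub hGs]
  exact (tsum_of_norm_bounded hsum.hasSum hFG).trans hle

/-- fix a totally real number field `K₀` of class number one and degree `N`,
and an even Schwartz function `φ` with compactly supported Fourier transform. There is a
constant `C > 0` (depending only on `φ` and `N`) such that for every CM-field `K` with
maximal totally real subfield `K₀`,
`|S_{2,1}(Δ, φ)₂ + 2·∑_𝔭 (log N𝔭/N𝔭^{1/2})·φ̂(log N𝔭/log Δ)| ≤ C`, the last sum running
over the principal primes `𝔭` of `O_K` whose absolute norm is the square of a rational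
prime. -/
theorem stmt_12.{u, v} (K₀ : Type u) [Field K₀] [NumberField K₀] (N : ℕ)
    (hN : Module.finrank ℚ K₀ = N)
    (hTR : ∀ ψ : K₀ →+* ℂ, ∀ z : K₀, (ψ z).im = 0)
    (hcl : NumberField.classNumber K₀ = 1)
    (φ : SchwartzMap ℝ ℂ) (heven : ∀ x : ℝ, φ (-x) = φ x)
    (hsupp : HasCompactSupport (𝓕 ⇑φ)) :
    ∃ C : ℝ, 0 < C ∧
      ∀ (K : Type v) [Field K] [NumberField K] [Algebra K₀ K],
        Module.finrank K₀ K = 2 →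
        IsEmpty (K →+* ℝ) →
        ‖S21two K φ ((NumberField.discr K).natAbs : ℝ) +
          (2 : ℂ) * ∑' 𝔭 : {𝔭 : Ideal (𝓞 K) // 𝔭.IsPrime ∧ Submodule.IsPrincipal 𝔭 ∧
              ∃ p : ℕ, p.Prime ∧ Ideal.absNorm 𝔭 = p ^ 2},
            ((Real.log (Ideal.absNorm 𝔭.1) /
                ((Ideal.absNorm 𝔭.1 : ℝ) ^ ((1 : ℝ) / 2)) : ℝ) : ℂ) *
              𝓕 ⇑φ (Real.log (Ideal.absNorm 𝔭.1) /
                Real.log ((NumberField.discr K).natAbs : ℝ))‖ ≤ C := by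
  have hcont : Continuous (𝓕 ⇑φ) := by
    rw [← SchwartzMap.fourier_coe]; exact (𝓕 φ).continuous
  obtain ⟨M, hM⟩ := hsupp.exists_bound_of_continuous hcont
  have hM0 : 0 ≤ M := (norm_nonneg _).trans (hM 0)
  have hB : 0 ≤ ∑' n : ℕ, 8 * M * (n : ℝ) ^ (-(3 / 2) : ℝ) :=
    tsum_nonneg fun n ↦ by positivity
  refine ⟨2 * (N * ∑' n : ℕ, 8 * M * (n : ℝ) ^ (-(3 / 2) : ℝ)) + 1, by positivity, ?_⟩
  intro K _ _ _ hK _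
  have hrank : Module.finrank ℚ K = N * 2 := by
    rw [← hN, ← hK, Module.finrank_mul_finrank]
  have hNpos : 0 < N := hN ▸ Module.finrank_pos
  have hL : 0 < Real.log ((discr K).natAbs : ℝ) := by
    have := abs_discr_gt_two (K := K) (by omega)
    rw [Int.abs_eq_natAbs] at this
    exact Real.log_pos (by exact_mod_cast (by omega : 1 < (discr K).natAbs))
  let π : {𝔭 : Ideal (𝓞 K) // 𝔭.IsPrime ∧ Submodule.IsPrincipal 𝔭 ∧
      ∃ p : ℕ, p.Prime ∧ Ideal.absNorm 𝔭 = p ^ 2} → ℕ := fun 𝔭 ↦ 𝔭.2.2.2.choose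
  have hπ (𝔭) : (π 𝔭).Prime ∧ Ideal.absNorm 𝔭.1 = π 𝔭 ^ 2 := 𝔭.2.2.2.choose_spec
  have hk (s : Finset _) (b : ℕ) : (s.filter (π · = b)).card ≤ N := by
    by_cases hb : b.Prime
    · have := card_primes_absNorm_sq_le hb ((s.filter (π · = b)).map (.subtype _)) fun 𝔭 h ↦ by
        obtain ⟨𝔮, h𝔮, rfl⟩ := Finset.mem_map.mp h
        exact ⟨𝔮.2.1, (Finset.mem_filter.mp h𝔮).2 ▸ (hπ 𝔮).2⟩
      rw [Finset.card_map] at this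
      omega
    · rw [Finset.filter_false_of_mem fun 𝔭 _ (h : π 𝔭 = b) ↦ hb (h ▸ (hπ 𝔭).1), Finset.card_empty]
      exact N.zero_le
  have key := norm_tsum_sub_tsum_le (fun 𝔭 ↦ (hπ 𝔭).1.two_le) hk
    (Q := (Nat.Coprime · (classNumber K))) (Nat.coprime_one_left _) hsupp hM hL
  have hcast (𝔭) : (π 𝔭 ^ 2 : ℝ) = (Ideal.absNorm 𝔭.1 : ℝ) := by
    rw [(hπ 𝔭).2]; push_cast; rfl
  simp only [hcast] at key
  rw [S21two, neg_mul, neg_add_eq_sub, ← mul_sub, norm_mul, norm_sub_rev, Complex.norm_ofNat]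
  linarith
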